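/- arXiv:1203.4278 — 3 statements merged into one kernel-verified Lean document; each statement's English description precedes it below -/
import Mathlib

section
/- Define the annihilation and creation functions a = (x¹ + i x²)/√2 and ā = (x¹ − i x²)/√2 on ℝ². With the twisted Moyal star product ⋆, their star commutator satisfies [a, ā]_⋆(x) = θ e⁻¹(x) for every x ∈ ℝ². -/
/-- The determinant function `e⁻¹(x₁,x₂) = 1 + ω₂x₂ − ω₁x₁`. -/
noncomputable def einv (ω₁ ω₂ : ℝ) (x : ℝ × ℝ) : ℝ := 1 + ω₂ * x.2 - ω₁ * x.1

/-- Partial derivative `∂₁` of a function `ℝ² → ℂ`. -/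
noncomputable def pd1 (f : ℝ × ℝ → ℂ) : ℝ × ℝ → ℂ := fun x => fderiv ℝ f x (1, 0)

/-- Partial derivative `∂₂` of a function `ℝ² → ℂ`. -/
noncomputable def pd2 (f : ℝ × ℝ → ℂ) : ℝ × ℝ → ℂ := fun x => fderiv ℝ f x (0, 1)

/-- The twisted Moyal star product:
`(f ⋆ g)(x) = Σ_{n=0}^∞ (1/n!) (iθe⁻¹(x)/2)^n Σ_{k=0}^n (−1)^{n−k} C(n,k)
(∂₁^k∂₂^{n−k}f)(x) (∂₂^k∂₁^{n−k}g)(x)`. -/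
noncomputable def tstar (θ ω₁ ω₂ : ℝ) (f g : ℝ × ℝ → ℂ) : ℝ × ℝ → ℂ := fun x =>
  ∑' n : ℕ, (1 / (n.factorial : ℂ)) * (Complex.I * (θ : ℂ) * (einv ω₁ ω₂ x : ℂ) / 2) ^ n *
    ∑ k ∈ Finset.range (n + 1), (-1 : ℂ) ^ (n - k) * (n.choose k : ℂ) *
      (pd1^[k] (pd2^[n - k] f) x) * (pd2^[k] (pd1^[n - k] g) x)

/-- The star commutator `[f,g]_⋆ = f⋆g − g⋆f`. -/
noncomputable def starComm (θ ω₁ ω₂ : ℝ) (f g : ℝ × ℝ → ℂ) : ℝ × ℝ → ℂ :=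
  fun x => tstar θ ω₁ ω₂ f g x - tstar θ ω₁ ω₂ g f x

/-- The annihilation function `a = (x¹ + i x²)/√2`. -/
noncomputable def annF : ℝ × ℝ → ℂ := fun x => ((x.1 : ℂ) + Complex.I * (x.2 : ℂ)) / Real.sqrt 2

/-- The creation function `ā = (x¹ − i x²)/√2`. -/
noncomputable def creF : ℝ × ℝ → ℂ := fun x => ((x.1 : ℂ) - Complex.I * (x.2 : ℂ)) / Real.sqrt 2

/-- The linear function `x ↦ p x₁ + q x₂` with complex coefficients. -/
def linF (p q : ℂ) : ℝ × ℝ → ℂ := fun x => p * (x.1 : ℂ) + q * (x.2 : ℂ)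

lemma hasFDerivAt_linF (p q : ℂ) (x : ℝ × ℝ) :
    HasFDerivAt (linF p q)
      (p • Complex.ofRealCLM.comp (ContinuousLinearMap.fst ℝ ℝ ℝ) +
        q • Complex.ofRealCLM.comp (ContinuousLinearMap.snd ℝ ℝ ℝ)) x :=
  (p • Complex.ofRealCLM.comp (ContinuousLinearMap.fst ℝ ℝ ℝ) +
    q • Complex.ofRealCLM.comp (ContinuousLinearMap.snd ℝ ℝ ℝ)).hasFDerivAt

lemma pd1_linF (p q : ℂ) : pd1 (linF p q) = fun _ => p := by
  funext x
  simp [pd1, (hasFDerivAt_linF p q x).fderiv]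

lemma pd2_linF (p q : ℂ) : pd2 (linF p q) = fun _ => q := by
  funext x
  simp [pd2, (hasFDerivAt_linF p q x).fderiv]

lemma pd1_const (c : ℂ) : pd1 (fun _ => c) = fun _ => 0 := by
  funext x
  simp [pd1]

lemma pd2_const (c : ℂ) : pd2 (fun _ => c) = fun _ => 0 := by
  funext x
  simp [pd2]

lemma pd1_iterate_succ_const (k : ℕ) (c : ℂ) : pd1^[k + 1] (fun _ => c) = fun _ => 0 := by
  induction k generalizing c with
  | zero => exact pd1_const c
  | succ k ih => rw [Function.iterate_succ_apply, pd1_const, ih]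

lemma pd2_iterate_succ_const (k : ℕ) (c : ℂ) : pd2^[k + 1] (fun _ => c) = fun _ => 0 := by
  induction k generalizing c with
  | zero => exact pd2_const c
  | succ k ih => rw [Function.iterate_succ_apply, pd2_const, ih]

/-- All partial derivatives of order at least two of a linear function vanish. -/
lemma pd1_iterate_pd2_iterate_linF (p q : ℂ) :
    ∀ k m : ℕ, 2 ≤ k + m → pd1^[k] (pd2^[m] (linF p q)) = fun _ => 0
  | 0, 0, h | 0, 1, h | 1, 0, h => by omega
  | k + 2, 0, _ => by
    rw [Function.iterate_zero_apply, Function.iterate_succ_apply, pd1_linF,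
      pd1_iterate_succ_const]
  | k + 1, 1, _ => by
    rw [Function.iterate_one, pd2_linF, pd1_iterate_succ_const]
  | 0, m + 2, _ => by
    rw [Function.iterate_zero_apply, Function.iterate_succ_apply, pd2_linF,
      pd2_iterate_succ_const]
  | k + 1, m + 2, _ => by
    rw [Function.iterate_succ_apply pd2, pd2_linF, pd2_iterate_succ_const,
      pd1_iterate_succ_const]

/-- The star product of two linear functions is their product plus the Poisson bracket term. -/
lemma tstar_linF (θ ω₁ ω₂ : ℝ) (p q r s : ℂ) (x : ℝ × ℝ) :
    tstar θ ω₁ ω₂ (linF p q) (linF r s) x =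
      linF p q x * linF r s x +
        Complex.I * (θ : ℂ) * (einv ω₁ ω₂ x : ℂ) / 2 * (p * s - q * r) := by
  unfold tstar
  rw [tsum_eq_sum (s := Finset.range 2)]
  · simp [Finset.sum_range_succ, pd1_linF, pd2_linF, -add_right_inj, -mul_eq_mul_left_iff]
    ring
  · intro n hn
    rw [Finset.mem_range, not_lt] at hn
    rw [Finset.sum_eq_zero, mul_zero]
    intro k hk
    rw [Finset.mem_range] at hk
    rw [pd1_iterate_pd2_iterate_linF p q k (n - k) (by omega)]
    simp

lemma annF_eq_linF : annF = linF (1 / Real.sqrt 2) (Complex.I / Real.sqrt 2) := by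
  funext x
  simp only [annF, linF]
  ring

lemma creF_eq_linF : creF = linF (1 / Real.sqrt 2) (-Complex.I / Real.sqrt 2) := by
  funext x
  simp only [creF, linF]
  ring

/-- The star commutator of the annihilation and creation functions:
`[a, ā]_⋆(x) = θ e⁻¹(x)` for every `x ∈ ℝ²`. -/
theorem starComm_ann_cre (θ ω₁ ω₂ : ℝ) :
    ∀ x : ℝ × ℝ, starComm θ ω₁ ω₂ annF creF x = (θ : ℂ) * (einv ω₁ ω₂ x : ℂ) := by
  intro x
  have hsqrt : ((Real.sqrt 2 : ℝ) : ℂ)⁻¹ ^ 2 = 1 / 2 := by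
    rw [inv_pow, ← Complex.ofReal_pow, Real.sq_sqrt (by norm_num)]
    norm_num
  rw [starComm, annF_eq_linF, creF_eq_linF, tstar_linF, tstar_linF]
  simp only [div_eq_mul_inv, one_mul]
  linear_combination
    (-2 * Complex.I ^ 2 * (θ : ℂ) * (einv ω₁ ω₂ x : ℂ)) * hsqrt -
      (θ : ℂ) * (einv ω₁ ω₂ x : ℂ) * Complex.I_sq
end

section
/- With the twisted Moyal star product ⋆, the coordinate functions satisfy the star Jacobi identity: for all μ, ν, ρ ∈ {1,2}, [x^μ, [x^ν, x^ρ]_⋆]_⋆ + [x^ρ, [x^μ, x^ν]_⋆]_⋆ + [x^ν, [x^ρ, x^μ]_⋆]_⋆ = 0 as functions on ℝ² (all iterated brackets are star commutators of polynomial functions). -/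
/-- The coordinate functions `x¹, x²` on `ℝ²`, indexed by `Fin 2`. -/
noncomputable def coordF : Fin 2 → ℝ × ℝ → ℂ := fun μ x => if μ = 0 then (x.1 : ℂ) else (x.2 : ℂ)

/-- The affine function `x ↦ a + b x₁ + c x₂` on `ℝ²` with complex coefficients. -/
noncomputable def affineFun (a b c : ℂ) : ℝ × ℝ → ℂ := fun x => a + b * x.1 + c * x.2

lemma hasFDerivAt_affineFun (a b c : ℂ) (x : ℝ × ℝ) :
    HasFDerivAt (affineFun a b c)
      (b • Complex.ofRealCLM.comp (ContinuousLinearMap.fst ℝ ℝ ℝ) +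
        c • Complex.ofRealCLM.comp (ContinuousLinearMap.snd ℝ ℝ ℝ)) x := by
  have h₁ : HasFDerivAt (fun y : ℝ × ℝ => (y.1 : ℂ))
      (Complex.ofRealCLM.comp (ContinuousLinearMap.fst ℝ ℝ ℝ)) x :=
    (Complex.ofRealCLM.comp (ContinuousLinearMap.fst ℝ ℝ ℝ)).hasFDerivAt
  have h₂ : HasFDerivAt (fun y : ℝ × ℝ => (y.2 : ℂ))
      (Complex.ofRealCLM.comp (ContinuousLinearMap.snd ℝ ℝ ℝ)) x :=
    (Complex.ofRealCLM.comp (ContinuousLinearMap.snd ℝ ℝ ℝ)).hasFDerivAt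
  exact ((h₁.const_mul b).const_add a).add (h₂.const_mul c)

lemma pd1_affineFun (a b c : ℂ) : pd1 (affineFun a b c) = affineFun b 0 0 := by
  funext x
  simp [pd1, (hasFDerivAt_affineFun a b c x).fderiv, affineFun]

lemma pd2_affineFun (a b c : ℂ) : pd2 (affineFun a b c) = affineFun c 0 0 := by
  funext x
  simp [pd2, (hasFDerivAt_affineFun a b c x).fderiv, affineFun]

lemma pd1_iterate_zero (k : ℕ) : pd1^[k] (affineFun 0 0 0) = affineFun 0 0 0 :=
  Function.iterate_fixed (pd1_affineFun 0 0 0) k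

lemma pd2_iterate_zero (k : ℕ) : pd2^[k] (affineFun 0 0 0) = affineFun 0 0 0 :=
  Function.iterate_fixed (pd2_affineFun 0 0 0) k

/-- Mixed partial derivatives of order at least two of an affine function vanish. -/
lemma pd1_iterate_pd2_iterate_affineFun (a b c : ℂ) {k m : ℕ} (h : 2 ≤ k + m) :
    pd1^[k] (pd2^[m] (affineFun a b c)) = affineFun 0 0 0 := by
  match m, k, h with
  | 0, k + 2, _ => simp [pd1_affineFun, pd1_iterate_zero]
  | 1, k + 1, _ => simp [pd1_affineFun, pd2_affineFun, pd1_iterate_zero]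
  | m + 2, k, _ => simp [pd2_affineFun, pd1_iterate_zero, pd2_iterate_zero]

lemma tstar_affineFun (θ ω₁ ω₂ : ℝ) (a b c a₁ b₁ c₁ : ℂ) (x : ℝ × ℝ) :
    tstar θ ω₁ ω₂ (affineFun a b c) (affineFun a₁ b₁ c₁) x =
      affineFun a b c x * affineFun a₁ b₁ c₁ x +
        Complex.I * θ * einv ω₁ ω₂ x / 2 * (b * c₁ - c * b₁) := by
  unfold tstar
  rw [tsum_eq_sum (s := Finset.range 2)]
  · simp [Finset.sum_range_succ, pd1_affineFun, pd2_affineFun]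
    refine Or.inl ?_
    simp only [affineFun]
    ring
  · intro n hn
    rw [Finset.mem_range, not_lt] at hn
    refine mul_eq_zero_of_right _ (Finset.sum_eq_zero fun k hk => ?_)
    rw [Finset.mem_range] at hk
    rw [pd1_iterate_pd2_iterate_affineFun a b c (by lia)]
    simp [affineFun]

/-- The star commutator of two affine functions is again affine, proportional to `e⁻¹`. -/
lemma starComm_affineFun (θ ω₁ ω₂ : ℝ) (a b c a₁ b₁ c₁ : ℂ) :
    starComm θ ω₁ ω₂ (affineFun a b c) (affineFun a₁ b₁ c₁) =
      affineFun (Complex.I * θ * (b * c₁ - c * b₁)) (-(Complex.I * θ * (b * c₁ - c * b₁) * ω₁))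
        (Complex.I * θ * (b * c₁ - c * b₁) * ω₂) := by
  funext x
  simp only [starComm, tstar_affineFun, affineFun, einv]
  push_cast
  ring

/-- The star Jacobi identity for arbitrary affine functions. -/
lemma starJacobi_affineFun (θ ω₁ ω₂ : ℝ) (a b c a₁ b₁ c₁ a₂ b₂ c₂ : ℂ) (x : ℝ × ℝ) :
    starComm θ ω₁ ω₂ (affineFun a b c)
        (starComm θ ω₁ ω₂ (affineFun a₁ b₁ c₁) (affineFun a₂ b₂ c₂)) x
      + starComm θ ω₁ ω₂ (affineFun a₂ b₂ c₂)
        (starComm θ ω₁ ω₂ (affineFun a b c) (affineFun a₁ b₁ c₁)) x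
      + starComm θ ω₁ ω₂ (affineFun a₁ b₁ c₁)
        (starComm θ ω₁ ω₂ (affineFun a₂ b₂ c₂) (affineFun a b c)) x = 0 := by
  simp only [starComm_affineFun, affineFun]
  ring

lemma coordF_eq_affineFun (μ : Fin 2) :
    coordF μ = affineFun 0 (if μ = 0 then 1 else 0) (if μ = 0 then 0 else 1) := by
  funext x
  by_cases h : μ = 0 <;> simp [coordF, affineFun, h]

/-- The star Jacobi identity for the coordinate functions on the twisted Moyal plane:
`[x^μ, [x^ν, x^ρ]_⋆]_⋆ + [x^ρ, [x^μ, x^ν]_⋆]_⋆ + [x^ν, [x^ρ, x^μ]_⋆]_⋆ = 0`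
as functions on `ℝ²`. -/
theorem starJacobi_coord (θ ω₁ ω₂ : ℝ) :
    ∀ (μ ν ρ : Fin 2) (x : ℝ × ℝ),
      starComm θ ω₁ ω₂ (coordF μ) (starComm θ ω₁ ω₂ (coordF ν) (coordF ρ)) x
        + starComm θ ω₁ ω₂ (coordF ρ) (starComm θ ω₁ ω₂ (coordF μ) (coordF ν)) x
        + starComm θ ω₁ ω₂ (coordF ν) (starComm θ ω₁ ω₂ (coordF ρ) (coordF μ)) x = 0 := by
  intro μ ν ρ x
  simp only [coordF_eq_affineFun]
  exact starJacobi_affineFun θ ω₁ ω₂ _ _ _ _ _ _ _ _ _ x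
end

section
/- Let θ > 0, let k, E be real numbers, and set B = 1/θ, ν = |k|/2, a = ν + 1/2 − E/θ, b = 2ν + 1. Then the function χ(ρ) = ρ^ν e^{−Bρ} Φ(a, b; 2Bρ) satisfies the radial harmonic-oscillator equation ρ² χ''(ρ) + ρ χ'(ρ) − (1/θ²)(ρ² − 2Eρ + θ²k²/4) χ(ρ) = 0 for all ρ ∈ (0,∞). In particular, when a = −l for a nonnegative integer l, i.e. E = θ(l + (|k|+1)/2), Φ(−l,b;2Bρ) is a polynomial and χ is a square-integrable bound state of the harmonic oscillator on the Moyal plane. -/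
/-- The (real) confluent hypergeometric (Kummer) function
`Φ(a,b;z) = Σ_{k=0}^∞ ((a)_k/((b)_k k!)) z^k`, where `(λ)_k` is the Pochhammer symbol. -/
noncomputable def PhiR (a b z : ℝ) : ℝ :=
  ∑' k : ℕ, (Polynomial.eval a (ascPochhammer ℝ k)) /
      ((Polynomial.eval b (ascPochhammer ℝ k)) * (k.factorial : ℝ)) * z ^ k

/-- A power series whose coefficients are bounded by those of an exponential converges
absolutely. -/
theorem summable_mul_pow_of_abs_le {c : ℕ → ℝ} {C M : ℝ}
    (h : ∀ n, |c n| ≤ C * (M ^ n / n.factorial)) (z : ℝ) :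
    Summable fun n => c n * z ^ n := by
  refine Summable.of_norm_bounded
    (g := fun n : ℕ => C * ((M * |z|) ^ n / n.factorial))
    ((Real.summable_pow_div_factorial _).mul_left C) fun n => ?_
  rw [Real.norm_eq_abs, abs_mul, abs_pow, mul_pow]
  calc |c n| * |z| ^ n ≤ C * (M ^ n / n.factorial) * |z| ^ n := by gcongr; exact h n
    _ = _ := by ring

/-- Exponential bounds on coefficients are inherited by the derived series. -/
theorem abs_succ_mul_coeff_le {c : ℕ → ℝ} {C M : ℝ}
    (h : ∀ n, |c n| ≤ C * (M ^ n / n.factorial)) (n : ℕ) :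
    |((n : ℝ) + 1) * c (n + 1)| ≤ C * M * (M ^ n / n.factorial) := by
  have hn : (0 : ℝ) < n + 1 := by positivity
  rw [abs_mul, abs_of_pos hn]
  calc ((n : ℝ) + 1) * |c (n + 1)|
      ≤ (n + 1) * (C * (M ^ (n + 1) / (n + 1).factorial)) := by gcongr; exact h _
    _ = _ := by
      rw [Nat.factorial_succ, pow_succ]
      push_cast
      field_simp

theorem hasDerivAt_tsum_mul_pow {c : ℕ → ℝ} {C M : ℝ}
    (h : ∀ n, |c n| ≤ C * (M ^ n / n.factorial)) (z : ℝ) :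
    HasDerivAt (fun z => ∑' n, c n * z ^ n) (∑' n : ℕ, ((n : ℝ) + 1) * c (n + 1) * z ^ n) z := by
  have hd := abs_succ_mul_coeff_le h
  have hs : Summable fun n : ℕ => |(n : ℝ) * c n| * (|z| + 1) ^ (n - 1) := by
    rw [← summable_nat_add_iff 1]
    have := (summable_mul_pow_of_abs_le (c := fun n : ℕ => |((n : ℝ) + 1) * c (n + 1)|)
      (by simpa only [abs_abs] using hd) (|z| + 1))
    simpa using this
  have key := hasDerivAt_tsum_of_isPreconnected (t := Metric.ball (0 : ℝ) (|z| + 1))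
    (g := fun n z => c n * z ^ n) (g' := fun n z => c n * (n * z ^ (n - 1))) (y₀ := 0) (y := z)
    hs Metric.isOpen_ball (convex_ball _ _).isPreconnected
    (fun n y _ => (hasDerivAt_pow n y).const_mul _) (fun n y hy => ?_)
    (by simp; positivity) (summable_mul_pow_of_abs_le h 0) (by simp)
  · refine key.congr_deriv ?_
    have hs' : Summable fun n : ℕ => c n * (n * z ^ (n - 1)) := by
      rw [← summable_nat_add_iff 1]
      refine (summable_mul_pow_of_abs_le hd z).congr fun n => ?_
      simp
      ring
    rw [hs'.tsum_eq_zero_add]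
    simp only [Nat.cast_zero, zero_mul, mul_zero, zero_add]
    refine tsum_congr fun n => ?_
    simp
    ring
  · have hy' : |y| ≤ |z| + 1 := by simpa using (Metric.mem_ball.1 hy).le
    rw [Real.norm_eq_abs, ← mul_assoc, abs_mul, abs_pow, mul_comm (c n)]
    gcongr

/-- The Taylor coefficients of the Kummer function `PhiR a b`. -/
noncomputable def kummerCoeff (a b : ℝ) (n : ℕ) : ℝ :=
  (ascPochhammer ℝ n).eval a / ((ascPochhammer ℝ n).eval b * n.factorial)

theorem kummerCoeff_succ {b : ℝ} (a : ℝ) (hb : 0 < b) (n : ℕ) :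
    (b + n) * ((n + 1) * kummerCoeff a b (n + 1)) = (a + n) * kummerCoeff a b n := by
  have hp : 0 < (ascPochhammer ℝ n).eval b := ascPochhammer_pos n b hb
  have hbn : 0 < b + n := by positivity
  rw [kummerCoeff, kummerCoeff, ascPochhammer_succ_eval, ascPochhammer_succ_eval,
    Nat.factorial_succ]
  push_cast
  field_simp

theorem abs_kummerCoeff_le {b : ℝ} (a : ℝ) (hb : 0 < b) (n : ℕ) :
    |kummerCoeff a b n| ≤ 1 * ((|a| / b + 1) ^ n / n.factorial) := by
  induction n with
  | zero => simp [kummerCoeff]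
  | succ n ih =>
    have hbn : 0 < b + n := by positivity
    have hn : (0 : ℝ) < n + 1 := by positivity
    have hstep : kummerCoeff a b (n + 1) = (a + n) / (b + n) / (n + 1) * kummerCoeff a b n := by
      have := kummerCoeff_succ a hb n
      field_simp
      linarith
    have hratio : |(a + n) / (b + n)| ≤ |a| / b + 1 := by
      rw [abs_div, abs_of_pos hbn, div_le_iff₀ hbn]
      have h1 : |a + n| ≤ |a| + n := by simpa using abs_add_le a (n : ℝ)
      have h2 : (|a| / b + 1) * (b + n) = |a| + n + (b + |a| / b * n) := by
        field_simp
        ring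
      have h3 : 0 ≤ b + |a| / b * n := by positivity
      linarith
    rw [hstep, abs_mul, abs_div, abs_of_pos hn]
    calc |(a + n) / (b + n)| / (n + 1) * |kummerCoeff a b n|
        ≤ (|a| / b + 1) / (n + 1) * (1 * ((|a| / b + 1) ^ n / n.factorial)) := by gcongr
      _ = _ := by
        rw [Nat.factorial_succ, pow_succ]
        push_cast
        field_simp

/-- The first derivative of `PhiR a b`, as a power series. -/
noncomputable def PhiRDeriv (a b z : ℝ) : ℝ :=
  ∑' n : ℕ, ((n : ℝ) + 1) * kummerCoeff a b (n + 1) * z ^ n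

/-- The second derivative of `PhiR a b`, as a power series. -/
noncomputable def PhiRDeriv₂ (a b z : ℝ) : ℝ :=
  ∑' n : ℕ, ((n : ℝ) + 1) * (((n + 1 : ℕ) + 1) * kummerCoeff a b (n + 1 + 1)) * z ^ n

theorem hasDerivAt_PhiR {b : ℝ} (a : ℝ) (hb : 0 < b) (z : ℝ) :
    HasDerivAt (PhiR a b) (PhiRDeriv a b z) z :=
  hasDerivAt_tsum_mul_pow (abs_kummerCoeff_le a hb) z

theorem hasDerivAt_PhiRDeriv {b : ℝ} (a : ℝ) (hb : 0 < b) (z : ℝ) :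
    HasDerivAt (PhiRDeriv a b) (PhiRDeriv₂ a b z) z :=
  hasDerivAt_tsum_mul_pow (abs_succ_mul_coeff_le (abs_kummerCoeff_le a hb)) z

/-- Kummer's differential equation. -/
theorem kummer_equation {b : ℝ} (a : ℝ) (hb : 0 < b) (z : ℝ) :
    z * PhiRDeriv₂ a b z + (b - z) * PhiRDeriv a b z - a * PhiR a b z = 0 := by
  have h0 := abs_kummerCoeff_le a hb
  have h1 := abs_succ_mul_coeff_le h0
  have h2 := abs_succ_mul_coeff_le h1
  have s0 : HasSum (fun n => kummerCoeff a b n * z ^ n) (PhiR a b z) :=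
    (summable_mul_pow_of_abs_le h0 z).hasSum
  have s1 : HasSum (fun n : ℕ => ((n : ℝ) + 1) * kummerCoeff a b (n + 1) * z ^ n)
      (PhiRDeriv a b z) := (summable_mul_pow_of_abs_le h1 z).hasSum
  have s2 : HasSum (fun n : ℕ => ((n : ℝ) + 1) * (((n + 1 : ℕ) + 1) *
      kummerCoeff a b (n + 1 + 1)) * z ^ n) (PhiRDeriv₂ a b z) :=
    (summable_mul_pow_of_abs_le h2 z).hasSum
  have s1' : HasSum (fun n : ℕ => n * kummerCoeff a b n * z ^ n) (z * PhiRDeriv a b z) := by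
    rw [← hasSum_nat_add_iff' 1]
    simp only [Finset.range_one, Finset.sum_singleton, Nat.cast_zero, zero_mul, sub_zero]
    refine (s1.mul_left z).congr_fun fun n => ?_
    push_cast
    ring
  have s2' : HasSum (fun n : ℕ => n * ((n + 1) * kummerCoeff a b (n + 1)) * z ^ n)
      (z * PhiRDeriv₂ a b z) := by
    rw [← hasSum_nat_add_iff' 1]
    simp only [Finset.range_one, Finset.sum_singleton, Nat.cast_zero, zero_mul, sub_zero]
    refine (s2.mul_left z).congr_fun fun n => ?_
    push_cast
    ring
  have s := ((s2'.add (s1.mul_left b)).sub s1').sub (s0.mul_left a)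
  have hz : HasSum (fun _ : ℕ => (0 : ℝ)) (z * PhiRDeriv₂ a b z + b * PhiRDeriv a b z -
      z * PhiRDeriv a b z - a * PhiR a b z) := by
    refine s.congr_fun fun n => ?_
    linear_combination (-z ^ n) * kummerCoeff_succ a hb n
  linear_combination hz.unique hasSum_zero

/-- For a nonpositive integer first parameter the Kummer series terminates. -/
theorem exists_polynomial_PhiR_neg_nat (l : ℕ) (b s : ℝ) :
    ∃ p : Polynomial ℝ, ∀ x : ℝ, PhiR (-(l : ℝ)) b (s * x) = p.eval x := by
  refine ⟨∑ n ∈ Finset.range (l + 1), Polynomial.C (kummerCoeff (-(l : ℝ)) b n * s ^ n) *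
    Polynomial.X ^ n, fun x => ?_⟩
  rw [PhiR, tsum_eq_sum (s := Finset.range (l + 1)), Polynomial.eval_finsetSum]
  · refine Finset.sum_congr rfl fun n _ => ?_
    simp only [kummerCoeff, Polynomial.eval_mul, Polynomial.eval_C, Polynomial.eval_pow,
      Polynomial.eval_X]
    ring
  · intro n hn
    rw [ascPochhammer_eval_neg_coe_nat_of_lt (by simpa using hn)]
    simp

theorem integrableOn_rpow_mul_exp_mul_polynomial {μ s : ℝ} (hμ : -1 < μ) (hs : 0 < s)
    (p : Polynomial ℝ) :
    MeasureTheory.IntegrableOn (fun x : ℝ => x ^ μ * Real.exp (-s * x) * p.eval x)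
      (Set.Ioi 0) := by
  have hsum : MeasureTheory.IntegrableOn (fun x : ℝ => ∑ n ∈ Finset.range (p.natDegree + 1),
      p.coeff n * (x ^ (μ + n) * Real.exp (-s * x ^ (1 : ℝ)))) (Set.Ioi 0) := by
    refine MeasureTheory.integrable_finsetSum _ fun n _ => ?_
    have hn : -1 < μ + n := by linarith [(Nat.cast_nonneg n : (0 : ℝ) ≤ n)]
    exact (integrableOn_rpow_mul_exp_neg_mul_rpow hn one_pos hs).const_mul _
  refine hsum.congr_fun (fun x hx => ?_) measurableSet_Ioi
  simp only [Polynomial.eval_eq_sum_range, Finset.mul_sum]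
  refine Finset.sum_congr rfl fun n _ => ?_
  rw [Real.rpow_add hx, Real.rpow_natCast, Real.rpow_one]
  ring

/-- With `θ > 0`, `B = 1/θ`, `ν = |k|/2`, `a = ν + 1/2 − E/θ`, `b = 2ν + 1`, the function
`χ(ρ) = ρ^ν e^{−Bρ} Φ(a,b;2Bρ)` satisfies the radial harmonic-oscillator equation
`ρ² χ'' + ρ χ' − (1/θ²)(ρ² − 2Eρ + θ²k²/4) χ = 0` on `(0,∞)`.  In particular, when
`a = −l` for a nonnegative integer `l`, `Φ(−l,b;2Bρ)` is a polynomial in `ρ` and `χ` is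
square integrable on `(0,∞)` (a bound state). -/
theorem radial_solution_kummer (θ B k E ν a b : ℝ) (hθ : 0 < θ) (hB : B = 1 / θ)
    (hν : ν = |k| / 2) (ha : a = ν + 1 / 2 - E / θ) (hb : b = 2 * ν + 1) :
    (∀ ρ ∈ Set.Ioi (0 : ℝ),
        ρ ^ 2 * deriv (deriv (fun t : ℝ => t ^ ν * Real.exp (-B * t) * PhiR a b (2 * B * t))) ρ
          + ρ * deriv (fun t : ℝ => t ^ ν * Real.exp (-B * t) * PhiR a b (2 * B * t)) ρ
          - (1 / θ ^ 2) * (ρ ^ 2 - 2 * E * ρ + θ ^ 2 * k ^ 2 / 4)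
              * (ρ ^ ν * Real.exp (-B * ρ) * PhiR a b (2 * B * ρ)) = 0)
    ∧ (∀ l : ℕ, a = -(l : ℝ) →
        (∃ p : Polynomial ℝ, ∀ ρ : ℝ, PhiR a b (2 * B * ρ) = p.eval ρ)
        ∧ MeasureTheory.IntegrableOn
            (fun ρ : ℝ => (ρ ^ ν * Real.exp (-B * ρ) * PhiR a b (2 * B * ρ)) ^ 2)
            (Set.Ioi (0 : ℝ))) := by
  have hν0 : 0 ≤ ν := by rw [hν]; positivity
  have hb0 : 0 < b := by linarith
  have hB0 : 0 < B := by rw [hB]; positivity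
  refine ⟨fun ρ hρ => ?_, fun l hl => ?_⟩
  · have hd1 : ∀ t : ℝ, 0 < t →
        HasDerivAt (fun t : ℝ => t ^ ν * Real.exp (-B * t) * PhiR a b (2 * B * t))
          (t ^ ν * Real.exp (-B * t) * ((ν / t - B) * PhiR a b (2 * B * t)
            + 2 * B * PhiRDeriv a b (2 * B * t))) t := by
      intro t ht
      have e1 := Real.hasDerivAt_rpow_const (x := t) (p := ν) (Or.inl ht.ne')
      have e2 := ((hasDerivAt_id t).const_mul (-B)).exp
      have e3 := (hasDerivAt_PhiR a hb0 (2 * B * t)).comp t ((hasDerivAt_id t).const_mul (2 * B))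
      refine ((e1.mul e2).mul e3).congr_deriv ?_
      simp only [Real.rpow_sub_one ht.ne', id, Function.comp, Pi.mul_apply]
      ring
    have hρ0 : 0 < ρ := hρ
    have hd2 : HasDerivAt
        (fun t : ℝ => t ^ ν * Real.exp (-B * t) * ((ν / t - B) * PhiR a b (2 * B * t)
            + 2 * B * PhiRDeriv a b (2 * B * t)))
        (ρ ^ ν * Real.exp (-B * ρ) * (((ν / ρ - B) ^ 2 - ν / ρ ^ 2) * PhiR a b (2 * B * ρ)
          + 4 * B * (ν / ρ - B) * PhiRDeriv a b (2 * B * ρ)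
          + 4 * B ^ 2 * PhiRDeriv₂ a b (2 * B * ρ))) ρ := by
      have e1 := Real.hasDerivAt_rpow_const (x := ρ) (p := ν) (Or.inl hρ0.ne')
      have e2 := ((hasDerivAt_id ρ).const_mul (-B)).exp
      have el := (hasDerivAt_id ρ).const_mul (2 * B)
      have e3 := (hasDerivAt_PhiR a hb0 (2 * B * ρ)).comp ρ el
      have e4 := (hasDerivAt_PhiRDeriv a hb0 (2 * B * ρ)).comp ρ el
      have e5 := ((hasDerivAt_inv hρ0.ne').const_mul ν).sub_const B
      refine ((e1.mul e2).mul ((e5.mul e3).add (e4.const_mul (2 * B)))).congr_deriv ?_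
      simp only [Real.rpow_sub_one hρ0.ne', id, Function.comp, Pi.mul_apply, Pi.add_apply]
      field_simp
      ring
    have hev : deriv (fun t : ℝ => t ^ ν * Real.exp (-B * t) * PhiR a b (2 * B * t)) =ᶠ[nhds ρ]
        fun t : ℝ => t ^ ν * Real.exp (-B * t) * ((ν / t - B) * PhiR a b (2 * B * t)
            + 2 * B * PhiRDeriv a b (2 * B * t)) := by
      filter_upwards [Ioi_mem_nhds hρ0] with t ht using (hd1 t ht).deriv
    rw [hev.deriv_eq, hd2.deriv, (hd1 ρ hρ0).deriv]
    have hK := kummer_equation a hb0 (2 * B * ρ)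
    have hE : a = ν + 1 / 2 - E * B := by rw [ha, hB]; ring
    have hk : k ^ 2 = 4 * ν ^ 2 := by rw [hν, div_pow, sq_abs]; ring
    have hpot : (1 / θ ^ 2) * (ρ ^ 2 - 2 * E * ρ + θ ^ 2 * k ^ 2 / 4)
        = B ^ 2 * ρ ^ 2 - 2 * E * B ^ 2 * ρ + ν ^ 2 := by
      rw [hB, hk]
      field_simp
    rw [hpot]
    rw [hb] at hK ⊢
    generalize PhiRDeriv₂ a (2 * ν + 1) (2 * B * ρ) = F₂ at *
    generalize PhiRDeriv a (2 * ν + 1) (2 * B * ρ) = F₁ at *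
    generalize PhiR a (2 * ν + 1) (2 * B * ρ) = F at *
    rw [hE] at hK
    have h1 : ν / ρ * ρ = ν := div_mul_cancel₀ _ hρ0.ne'
    have h2 : ν / ρ ^ 2 * ρ ^ 2 = ν := div_mul_cancel₀ _ (by positivity)
    generalize ν / ρ = q at *
    generalize ν / ρ ^ 2 = q₂ at *
    subst h1
    linear_combination (ρ ^ (q * ρ) * Real.exp (-B * ρ)) * (2 * B * ρ * hK - F * h2)
  · subst hl
    obtain ⟨p, hp⟩ := exists_polynomial_PhiR_neg_nat l b (2 * B)
    refine ⟨⟨p, hp⟩, ?_⟩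
    refine (integrableOn_rpow_mul_exp_mul_polynomial (μ := ν + ν) (s := 2 * B)
      (by linarith) (by linarith) (p ^ 2)).congr_fun (fun x hx => ?_) measurableSet_Ioi
    have hexp : Real.exp (-(2 * B) * x) = Real.exp (-B * x) * Real.exp (-B * x) := by
      rw [← Real.exp_add]
      ring_nf
    simp only [hp, Polynomial.eval_pow, hexp, Real.rpow_add hx]
    ring
end
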